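/- Let K be a finite extension of F_p(t) and S a nonempty finite set of places of K. Then the group of S-units R_S* = {x ∈ K* : v(x) = 0 for all places v ∉ S} is a finitely generated abelian group whose quotient by K* ∩ F̄_p is free of rank |S| − 1. -/

import Mathlib

noncomputable section

/-- `v` is (the normalized additive valuation of) a place of the function field `K`
over `F_p(t)`: a surjective discrete valuation on `K`, trivial on the constants. -/
def IsPlace (p : ℕ) [Fact p.Prime] (K : Type) [Field K]
    [Algebra (RatFunc (ZMod p)) K] (v : K → WithTop ℤ) : Prop :=
  v 0 = ⊤ ∧ (∀ x : K, x ≠ 0 → v x ≠ ⊤) ∧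
    (∀ x y : K, v (x * y) = v x + v y) ∧
    (∀ x y : K, min (v x) (v y) ≤ v (x + y)) ∧
    (∀ c : ZMod p, c ≠ 0 → v (algebraMap (RatFunc (ZMod p)) K (RatFunc.C c)) = 0) ∧
    (∀ z : ℤ, ∃ x : K, v x = (z : WithTop ℤ))

/-- `x ∈ Kˣ` is an `S`-unit: `v(x) = 0` for every place `v ∉ S`. -/
def IsSUnit (p : ℕ) [Fact p.Prime] (K : Type) [Field K]
    [Algebra (RatFunc (ZMod p)) K] (S : Finset (K → WithTop ℤ)) (x : Kˣ) : Prop :=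
  ∀ v : K → WithTop ℤ, IsPlace p K v → v ∉ S → v (x : K) = 0

theorem LinearMap.exists_isCompl_ker_of_finsupp {R G ι : Type*} [CommRing R] [IsDomain R]
    [IsPrincipalIdealRing R] [AddCommGroup G] [Module R G] (D : G →ₗ[R] ι →₀ R) :
    ∃ C : Submodule R G, IsCompl D.ker C := by
  classical
  obtain ⟨hlin, hwf⟩ := exists_wellFoundedLT ι
  let W : ι → Submodule R G := fun i => (Finsupp.supported R R (Set.Iic i)).comap D
  let N : ι → Ideal R := fun i => (W i).map (Finsupp.lapply i ∘ₗ D)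
  have hg : ∀ i, ∃ g ∈ W i, D g i = Submodule.IsPrincipal.generator (N i) := fun i =>
    Submodule.IsPrincipal.generator_mem (N i)
  choose g hgW hgN using hg
  let I := {i // Submodule.IsPrincipal.generator (N i) ≠ 0}
  let L : (I →₀ R) →ₗ[R] G := Finsupp.linearCombination R (fun i : I => g i)
  refine ⟨L.range, ?_, ?_⟩
  · rw [Submodule.disjoint_def]
    rintro _ hx ⟨c, rfl⟩
    by_contra hne
    have hc : c ≠ 0 := by
      rintro rfl
      simp at hne
    let i := c.support.max' (Finsupp.support_nonempty_iff.2 hc)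
    have hi : i ∈ c.support := Finset.max'_mem _ _
    have h0 : D (L c) i = c i * Submodule.IsPrincipal.generator (N i) := by
      simp only [L, Finsupp.linearCombination_apply, Finsupp.sum, map_sum, map_smul,
        Finsupp.finsetSum_apply, Finsupp.smul_apply, smul_eq_mul]
      rw [Finset.sum_eq_single i]
      · rw [hgN]
      · intro j hj hji
        have hlt : j < i := lt_of_le_of_ne (Finset.le_max' _ _ hj) hji
        have : D (g j) i = 0 := by
          by_contra hne
          exact (show (i : ι) ≤ j from hgW j (Finsupp.mem_support_iff.2 hne)).not_gt hlt
        rw [this, mul_zero]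
      · exact fun h => absurd hi h
    rw [LinearMap.mem_ker.1 hx] at h0
    exact mul_ne_zero (Finsupp.mem_support_iff.1 hi) i.2 h0.symm
  · rw [codisjoint_iff, eq_top_iff]
    have key : ∀ i, W i ≤ D.ker ⊔ L.range := fun i => by
      induction i using WellFoundedLT.induction with
      | ind i ih =>
        intro x hx
        obtain ⟨c, hc⟩ := (Submodule.IsPrincipal.mem_iff_eq_smul_generator (N i)).1
          (Submodule.mem_map_of_mem hx)
        have hgL : g i ∈ D.ker ⊔ L.range ∨ D x i = 0 := by
          by_cases h : Submodule.IsPrincipal.generator (N i) = 0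
          · right
            rw [h] at hc
            simpa using hc
          · left
            exact le_sup_right (a := D.ker) ⟨Finsupp.single ⟨i, h⟩ 1, by simp [L]⟩
        obtain ⟨b, hb, hbW, hbi⟩ : ∃ b ∈ D.ker ⊔ L.range, x - b ∈ W i ∧ D (x - b) i = 0 := by
          rcases hgL with h | h
          · refine ⟨c • g i, Submodule.smul_mem _ _ h, sub_mem hx (Submodule.smul_mem _ _ (hgW i)),
              ?_⟩
            simp only [LinearMap.comp_apply, Finsupp.lapply_apply] at hc
            simp [hgN, hc]
          · exact ⟨0, zero_mem _, by simpa using hx, by simpa using h⟩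
        suffices x - b ∈ D.ker ⊔ L.range by simpa using add_mem this hb
        rcases (D (x - b)).support.eq_empty_or_nonempty with h | h
        · exact le_sup_left (a := D.ker) (Finsupp.support_eq_empty.1 h)
        · refine ih ((D (x - b)).support.max' h) (lt_of_le_of_ne (hbW (Finset.max'_mem _ _)) ?_)
            fun j hj => Finset.le_max' _ _ hj
          intro heq
          have := Finset.max'_mem _ h
          rw [heq, Finsupp.mem_support_iff] at this
          exact this hbi
    intro x _
    rcases (D x).support.eq_empty_or_nonempty with h | h
    · exact le_sup_left (a := D.ker) (Finsupp.support_eq_empty.1 h)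
    · exact key ((D x).support.max' h) fun j hj => Finset.le_max' _ _ hj

theorem LinearMap.exists_extend_ker_of_finsupp {R G A ι : Type*} [CommRing R] [IsDomain R]
    [IsPrincipalIdealRing R] [AddCommGroup G] [Module R G] [AddCommGroup A] [Module R A]
    (D : G →ₗ[R] ι →₀ R) (f : D.ker →ₗ[R] A) : ∃ F : G →ₗ[R] A, ∀ x : D.ker, F x = f x := by
  obtain ⟨C, hC⟩ := D.exists_isCompl_ker_of_finsupp
  exact ⟨f ∘ₗ Submodule.projectionOnto _ _ hC, fun x => by simp⟩

section Curve

open Polynomial IntermediateField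
open scoped IntermediateField.algebraAdjoinAdjoin

/-- A normalized discrete valuation on `K`, written additively. -/
structure Place (K : Type*) [Field K] where
  /-- The underlying additive valuation. -/
  val : AddValuation K (WithTop ℤ)
  surj : ∀ n : ℤ, ∃ x, val x = n

namespace Place

variable {K : Type*} [Field K]

/-- The order of `x` at `v` as an integer (with the junk value `0` at `x = 0`). -/
def ord (v : Place K) (x : K) : ℤ := (v.val x).untopD 0

theorem val_eq (v : Place K) {x : K} (hx : x ≠ 0) : v.val x = v.ord x := by
  obtain ⟨n, hn⟩ := WithTop.ne_top_iff_exists.1 (v.val.ne_top_iff.2 hx)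
  simp [ord, ← hn]

theorem ord_eq_of_val_eq (v : Place K) {x : K} {n : ℤ} (h : v.val x = n) : v.ord x = n := by
  simp [ord, h]

theorem ext_ord {v w : Place K} (h : ∀ x ≠ 0, v.ord x = w.ord x) : v = w := by
  obtain ⟨v, hv⟩ := v
  obtain ⟨w, hw⟩ := w
  congr 1
  refine AddValuation.ext fun x => ?_
  rcases eq_or_ne x 0 with rfl | hx
  · simp
  · have := h x hx
    have h1 := val_eq ⟨v, hv⟩ hx
    have h2 := val_eq ⟨w, hw⟩ hx
    rw [this] at h1
    exact h1.trans h2.symm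

@[simp] theorem ord_zero (v : Place K) : v.ord 0 = 0 := by simp [ord]

@[simp] theorem ord_one (v : Place K) : v.ord 1 = 0 := by simp [ord]

theorem ord_mul (v : Place K) {x y : K} (hx : x ≠ 0) (hy : y ≠ 0) :
    v.ord (x * y) = v.ord x + v.ord y := by
  apply v.ord_eq_of_val_eq
  rw [AddValuation.map_mul, v.val_eq hx, v.val_eq hy]
  rfl

@[simp] theorem ord_neg (v : Place K) (x : K) : v.ord (-x) = v.ord x := by
  simp [ord]

@[simp] theorem ord_inv (v : Place K) (x : K) : v.ord x⁻¹ = - v.ord x := by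
  rcases eq_or_ne x 0 with rfl | hx
  · simp
  · have := v.ord_mul hx (inv_ne_zero hx)
    rw [mul_inv_cancel₀ hx, ord_one] at this
    lia

theorem ord_pow (v : Place K) (x : K) (n : ℕ) : v.ord (x ^ n) = n * v.ord x := by
  rcases eq_or_ne x 0 with rfl | hx
  · rcases n with _ | n <;> simp
  · induction n with
    | zero => simp
    | succ n ih => rw [pow_succ, v.ord_mul (pow_ne_zero _ hx) hx, ih]; push_cast; ring

theorem exists_ord_eq (v : Place K) (n : ℤ) : ∃ x ≠ 0, v.ord x = n := by
  obtain ⟨x, hx⟩ := v.surj n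
  exact ⟨x, by rintro rfl; simp at hx, v.ord_eq_of_val_eq hx⟩

/-- The elements of order at least `n` at `v`. -/
def filt (v : Place K) (n : ℤ) : AddSubgroup K where
  carrier := {x | (n : WithTop ℤ) ≤ v.val x}
  zero_mem' := by simp
  add_mem' hx hy := v.val.map_le_add hx hy
  neg_mem' hx := by simpa using hx

theorem mem_filt (v : Place K) {n : ℤ} {x : K} : x ∈ v.filt n ↔ (n : WithTop ℤ) ≤ v.val x := Iff.rfl

theorem mem_filt_iff (v : Place K) {n : ℤ} {x : K} (hx : x ≠ 0) : x ∈ v.filt n ↔ n ≤ v.ord x := by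
  rw [mem_filt, v.val_eq hx]
  exact WithTop.coe_le_coe

theorem filt_anti (v : Place K) {m n : ℤ} (h : m ≤ n) : v.filt n ≤ v.filt m := fun _ hx =>
  (WithTop.coe_le_coe.2 h).trans hx

theorem mul_mem_filt (v : Place K) {m n : ℤ} {x y : K} (hx : x ∈ v.filt m) (hy : y ∈ v.filt n) :
    x * y ∈ v.filt (m + n) := by
  rw [mem_filt, AddValuation.map_mul]
  exact add_le_add ((mem_filt v).1 hx) ((mem_filt v).1 hy)

theorem mul_mem_filt_iff (v : Place K) {n : ℤ} {x y : K} (hx : x ≠ 0) :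
    x * y ∈ v.filt n ↔ y ∈ v.filt (n - v.ord x) := by
  rcases eq_or_ne y 0 with rfl | hy
  · simp [zero_mem]
  · rw [v.mem_filt_iff hy, v.mem_filt_iff (mul_ne_zero hx hy), v.ord_mul hx hy]
    lia

theorem ord_add_eq_of_lt (v : Place K) {x y : K} (hx : x ≠ 0) (hy : y ∈ v.filt (v.ord x + 1)) :
    x + y ≠ 0 ∧ v.ord (x + y) = v.ord x := by
  have h : v.val x < v.val y := by
    refine lt_of_lt_of_le ?_ hy
    rw [v.val_eq hx]
    exact WithTop.coe_lt_coe.2 (by lia)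
  have := v.val.map_add_eq_of_lt_left h
  refine ⟨v.val.ne_top_iff.1 ?_, ?_⟩
  · rw [this]
    exact v.val.ne_top_iff.2 hx
  · exact v.ord_eq_of_val_eq (this.trans (v.val_eq hx))

theorem exists_not_le (v w : Place K) (h : v ≠ w) : ∃ x ≠ 0, 0 ≤ v.ord x ∧ w.ord x < 0 := by
  by_contra! H
  have h0 : ∀ x ≠ 0, v.ord x = 0 → w.ord x = 0 := fun x hx hv => by
    have h1 := H x hx hv.ge
    have h2 := H x⁻¹ (inv_ne_zero hx) (by simp [hv])
    rw [ord_inv] at h2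
    lia
  obtain ⟨π, hπ, hπ1⟩ := v.exists_ord_eq 1
  have key : ∀ x ≠ 0, w.ord x = v.ord x * w.ord π := fun x hx => by
    rcases le_total 0 (v.ord x) with hn | hn
    · have := h0 (x * (π ^ (v.ord x).toNat)⁻¹) (mul_ne_zero hx (inv_ne_zero (pow_ne_zero _ hπ)))
        (by rw [ord_mul _ hx (inv_ne_zero (pow_ne_zero _ hπ)), ord_inv, ord_pow, hπ1]; lia)
      rw [ord_mul _ hx (inv_ne_zero (pow_ne_zero _ hπ)), ord_inv, ord_pow,
        Int.toNat_of_nonneg hn] at this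
      lia
    · have := h0 (x * (π ^ (-v.ord x).toNat)) (mul_ne_zero hx (pow_ne_zero _ hπ))
        (by rw [ord_mul _ hx (pow_ne_zero _ hπ), ord_pow, hπ1]; lia)
      rw [ord_mul _ hx (pow_ne_zero _ hπ), ord_pow, Int.toNat_of_nonneg (by lia)] at this
      linarith
  have h1 : w.ord π = 1 := by
    obtain ⟨x, hx, hx1⟩ := w.exists_ord_eq 1
    have h2 := H π hπ (by lia)
    have h3 : w.ord π ∣ 1 := ⟨v.ord x, by rw [← hx1, key x hx, mul_comm]⟩
    exact Int.eq_one_of_dvd_one h2 h3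
  exact h (ext_ord fun x hx => by rw [key x hx, h1, mul_one])

theorem exists_neg_pos (v w : Place K) (h : v ≠ w) : ∃ x ≠ 0, v.ord x < 0 ∧ 0 < w.ord x := by
  obtain ⟨x, hx, h1, h2⟩ := exists_not_le v w h
  obtain ⟨y, hy, h3, h4⟩ := exists_not_le w v h.symm
  refine ⟨y * x⁻¹, mul_ne_zero hy (inv_ne_zero hx), ?_, ?_⟩ <;>
  · rw [ord_mul _ hy (inv_ne_zero hx), ord_inv]
    lia

theorem ord_one_add_pow_of_neg (v : Place K) {x : K} (hx : x ≠ 0) (h : v.ord x < 0) {N : ℕ}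
    (hN : N ≠ 0) : 1 + x ^ N ≠ 0 ∧ v.ord (1 + x ^ N) = N * v.ord x := by
  have hx' := pow_ne_zero N hx
  rw [add_comm, ← ord_pow]
  refine v.ord_add_eq_of_lt hx' ?_
  rw [mem_filt_iff _ one_ne_zero, ord_one, ord_pow]
  have : (0 : ℤ) < N := by positivity
  nlinarith

theorem ord_one_add_pow_of_pos (v : Place K) {x : K} (hx : x ≠ 0) (h : 0 < v.ord x) {N : ℕ}
    (hN : N ≠ 0) : 1 + x ^ N ≠ 0 ∧ v.ord (1 + x ^ N) = 0 := by
  have hx' := pow_ne_zero N hx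
  rw [← v.ord_one]
  refine v.ord_add_eq_of_lt one_ne_zero ?_
  rw [mem_filt_iff _ hx', ord_one, ord_pow]
  have : (0 : ℤ) < N := by positivity
  nlinarith

theorem exists_neg_forall_pos (v : Place K) (T : Finset (Place K)) (hT : v ∉ T) :
    ∃ x ≠ 0, v.ord x < 0 ∧ ∀ w ∈ T, 0 < w.ord x := by
  classical
  induction T using Finset.induction_on with
  | empty =>
    obtain ⟨x, hx, h⟩ := v.exists_ord_eq (-1)
    exact ⟨x, hx, by lia, by simp⟩
  | insert w T hw ih =>
    simp only [Finset.mem_insert, not_or] at hT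
    obtain ⟨x, hx, hv, hxT⟩ := ih hT.2
    obtain ⟨y, hy, hyv, hyw⟩ := exists_neg_pos v w hT.1
    simp only [Finset.forall_mem_insert]
    obtain ⟨N, hN0, hN⟩ : ∃ N : ℕ, N ≠ 0 ∧ ∀ u ∈ T, 0 < N + u.ord y :=
      ⟨1 + ∑ u ∈ T, (u.ord y).natAbs, by lia, fun u hu => by
        have := Finset.single_le_sum (f := fun u => (u.ord y).natAbs) (fun _ _ => zero_le) hu
        lia⟩
    have hN0' : (0 : ℤ) < N := by lia
    have hxN := pow_ne_zero N hx
    rcases lt_trichotomy (w.ord x) 0 with hwx | hwx | hwx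
    · have h1 := ord_one_add_pow_of_neg v hx hv hN0
      have h2 := ord_one_add_pow_of_neg w hx hwx hN0
      have h3 := inv_ne_zero h1.1
      refine ⟨y * (x ^ N * (1 + x ^ N)⁻¹), mul_ne_zero hy (mul_ne_zero hxN h3), ?_, ?_, ?_⟩
      · rw [ord_mul _ hy (mul_ne_zero hxN h3), ord_mul _ hxN h3, ord_inv, h1.2, ord_pow]
        lia
      · rw [ord_mul _ hy (mul_ne_zero hxN h3), ord_mul _ hxN h3, ord_inv, h2.2, ord_pow]
        lia
      · intro u hu
        have h4 := ord_one_add_pow_of_pos u hx (hxT u hu) hN0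
        rw [ord_mul _ hy (mul_ne_zero hxN h3), ord_mul _ hxN h3, ord_inv, h4.2, ord_pow]
        have := hN u hu
        have := hxT u hu
        nlinarith
    · refine ⟨y * x ^ N, mul_ne_zero hy hxN, ?_, ?_, fun u hu => ?_⟩
      · rw [ord_mul _ hy hxN, ord_pow]
        nlinarith
      · rw [ord_mul _ hy hxN, ord_pow, hwx]
        lia
      · rw [ord_mul _ hy hxN, ord_pow]
        have := hN u hu
        have := hxT u hu
        nlinarith
    · exact ⟨x, hx, hv, hwx, hxT⟩

theorem exists_near_one (v : Place K) (T : Finset (Place K)) (hT : v ∉ T) (N : ℕ) :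
    ∃ x, x - 1 ∈ v.filt N ∧ ∀ w ∈ T, x ∈ w.filt N := by
  obtain ⟨x, hx, hv, hxT⟩ := v.exists_neg_forall_pos T hT
  have hN0 : N + 1 ≠ 0 := by lia
  have h1 := ord_one_add_pow_of_neg v hx hv hN0
  have h3 := inv_ne_zero h1.1
  have hxN := pow_ne_zero (N + 1) hx
  refine ⟨x ^ (N + 1) * (1 + x ^ (N + 1))⁻¹, ?_, fun w hw => ?_⟩
  · have : x ^ (N + 1) * (1 + x ^ (N + 1))⁻¹ - 1 = - (1 + x ^ (N + 1))⁻¹ := by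
      have := h1.1
      field_simp
      ring
    rw [this, mem_filt_iff _ (neg_ne_zero.2 h3), ord_neg, ord_inv, h1.2]
    push_cast
    nlinarith
  · have h2 := ord_one_add_pow_of_pos w hx (hxT w hw) hN0
    rw [mem_filt_iff _ (mul_ne_zero hxN h3), ord_mul _ hxN h3, ord_inv, h2.2, ord_pow]
    have := hxT w hw
    push_cast
    nlinarith

/-- Weak approximation. -/
theorem exists_approx (T : Finset (Place K)) (y : Place K → K) (N : ℤ) :
    ∃ x, ∀ v ∈ T, x - y v ∈ v.filt N := by
  classical
  obtain ⟨M, hM⟩ : ∃ M : ℕ, ∀ u ∈ T, ∀ v ∈ T, N - u.ord (y v) ≤ M :=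
    ⟨N.natAbs + ∑ u ∈ T, ∑ v ∈ T, (u.ord (y v)).natAbs, fun u hu v hv => by
      have h1 := Finset.single_le_sum (f := fun u => ∑ v ∈ T, (u.ord (y v)).natAbs)
        (fun _ _ => zero_le) hu
      have h2 := Finset.single_le_sum (f := fun v => (u.ord (y v)).natAbs)
        (fun _ _ => zero_le) hv
      lia⟩
  choose e he1 he2 using fun v : Place K => v.exists_near_one (T.erase v) (by simp) M
  have hmul : ∀ u ∈ T, ∀ v ∈ T, ∀ a ∈ u.filt M, a * y v ∈ u.filt N := fun u hu v hv a ha => by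
    rcases eq_or_ne (y v) 0 with h | h
    · simp [h, zero_mem]
    · rw [mul_comm, mul_mem_filt_iff _ h]
      exact u.filt_anti (hM u hu v hv) ha
  refine ⟨∑ v ∈ T, e v * y v, fun u hu => ?_⟩
  rw [← Finset.add_sum_erase _ _ hu, add_sub_right_comm]
  refine add_mem ?_ (sum_mem fun v hv => ?_)
  · rw [← sub_one_mul]
    exact hmul u hu u hu _ (he1 u)
  · have hv' := Finset.mem_erase.1 hv
    exact hmul u hu v hv'.2 _ (he2 v u (Finset.mem_erase.2 ⟨hv'.1.symm, hu⟩))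

/-- The number of elements of the residue field of `v` (or `0` if that is infinite). -/
def resCard (v : Place K) : ℕ := (v.filt 1).relIndex (v.filt 0)

theorem relIndex_filt_succ (v : Place K) (n : ℤ) :
    (v.filt (n + 1)).relIndex (v.filt n) = v.resCard := by
  obtain ⟨x, hx, hxn⟩ := v.exists_ord_eq n
  have : ∀ m, (v.filt m).map (AddMonoidHom.mulLeft x) = v.filt (m + n) := fun m => by
    ext y
    simp only [AddSubgroup.mem_map, AddMonoidHom.coe_mulLeft]
    constructor
    · rintro ⟨z, hz, rfl⟩
      rw [mul_mem_filt_iff _ hx, hxn]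
      simpa using hz
    · intro hy
      refine ⟨x⁻¹ * y, ?_, mul_inv_cancel_left₀ hx y⟩
      rw [mul_mem_filt_iff _ (inv_ne_zero hx), ord_inv, hxn]
      simpa using hy
  rw [resCard, ← AddSubgroup.relIndex_map_map_of_injective (v.filt 1) _
    (f := AddMonoidHom.mulLeft x) (mul_right_injective₀ hx), this, this, zero_add, add_comm]

theorem relIndex_filt (v : Place K) (m : ℤ) (n : ℕ) :
    (v.filt (m + n)).relIndex (v.filt m) = v.resCard ^ n := by
  induction n with
  | zero => simp
  | succ n ih =>
    rw [← AddSubgroup.relIndex_mul_relIndex _ (v.filt (m + n)) _ (v.filt_anti (by lia))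
      (v.filt_anti (by lia)), ih, Nat.cast_succ, ← add_assoc, relIndex_filt_succ, pow_succ']

theorem resCard_ne_one (v : Place K) : v.resCard ≠ 1 := by
  rw [resCard, Ne, AddSubgroup.relIndex_eq_one]
  intro h
  have : (1 : K) ∈ v.filt 1 := h (by simp [mem_filt_iff])
  simp [mem_filt_iff] at this

end Place

section Generic

variable {k K : Type*} [Field k] [Field K] [Algebra k K]

theorem aeval_eq_zero_of_linearIndependent_quotient {ι : Type*} [Fintype ι] {z : K} (hz : z ≠ 0)
    (O : Submodule k K) (hO : ∀ x ∈ O, z * x ∈ O) (a : ι → O)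
    (ha : LinearIndependent k
      (fun i => ((O.map (LinearMap.mulLeft k z)).submoduleOf O).mkQ (a i)))
    (f : ι → k[X]) (hf : ∑ i, aeval z (f i) * (a i : K) = 0) : f = 0 := by
  suffices H : ∀ (d : ℕ) (f : ι → k[X]), (∀ i n, d ≤ n → (f i).coeff n = 0) →
      ∑ i, aeval z (f i) * (a i : K) = 0 → f = 0 by
    refine H (1 + ∑ i, (f i).natDegree) f (fun i n hn => coeff_eq_zero_of_natDegree_lt ?_) hf
    have := Finset.single_le_sum (f := fun i => (f i).natDegree) (fun _ _ => zero_le)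
      (Finset.mem_univ i)
    lia
  have haeval : ∀ g : k[X], ∀ x ∈ O, aeval z g * x ∈ O := fun g x hx => by
    induction g using Polynomial.induction_on' with
    | add p q hp hq => rw [map_add, add_mul]; exact add_mem hp hq
    | monomial n c =>
      rw [aeval_monomial, mul_assoc, ← Algebra.smul_def]
      refine O.smul_mem _ ?_
      induction n with
      | zero => simpa
      | succ n ih => rw [pow_succ', mul_assoc]; exact hO _ ih
  intro d
  induction d with
  | zero =>
    intro f hf _
    ext i n
    exact hf i n n.zero_le
  | succ d ih =>
    intro f hf h
    have hsplit : ∀ i, aeval z (f i) = z * aeval z (divX (f i)) + algebraMap k K ((f i).coeff 0) :=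
      fun i => by
        conv_lhs => rw [← X_mul_divX_add (f i)]
        rw [map_add, map_mul, aeval_X, aeval_C]
    have hsum : z * ∑ i, aeval z (divX (f i)) * (a i : K) +
        ∑ i, (f i).coeff 0 • (a i : K) = 0 := by
      rw [← h, Finset.mul_sum, ← Finset.sum_add_distrib]
      refine Finset.sum_congr rfl fun i _ => ?_
      rw [hsplit, Algebra.smul_def]
      ring
    have h0 : ∀ i, (f i).coeff 0 = 0 := by
      rw [Fintype.linearIndependent_iff] at ha
      refine ha (fun i => (f i).coeff 0) ?_
      simp_rw [← map_smul, ← map_sum]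
      rw [Submodule.mkQ_apply, Submodule.Quotient.mk_eq_zero, Submodule.submoduleOf,
        Submodule.mem_comap]
      refine ⟨- ∑ i, aeval z (divX (f i)) * (a i : K),
        neg_mem (sum_mem fun i _ => haeval _ _ (a i).2), ?_⟩
      simp only [LinearMap.mulLeft_apply, mul_neg, map_sum, map_smul, Submodule.subtype_apply]
      linear_combination -hsum
    have h1 := ih (fun i => divX (f i))
      (fun i n hn => by rw [coeff_divX]; exact hf i _ (by lia)) (by
      simp only [h0, zero_smul, Finset.sum_const_zero, add_zero, mul_eq_zero, hz,
        false_or] at hsum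
      exact hsum)
    ext1 i
    have := congrFun h1 i
    rw [← X_mul_divX_add (f i), h0]
    simpa using this

theorem linearIndependent_of_aeval {ι : Type*} [Fintype ι] (z : K) (a : ι → K)
    (h : ∀ f : ι → k[X], ∑ i, aeval z (f i) * a i = 0 → f = 0) :
    LinearIndependent k⟮z⟯ a := by
  rw [← LinearIndependent.iff_fractionRing (R := Algebra.adjoin k {z}), Fintype.linearIndependent_iff]
  intro g hg
  have : ∀ i, ∃ f : k[X], aeval z f = (g i : K) := fun i =>
    (Algebra.adjoin_singleton_eq_range_aeval k z).le (g i).2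
  choose f hf using this
  have hf0 := h f (by
    rw [← hg]
    refine Finset.sum_congr rfl fun i _ => ?_
    rw [hf]
    rfl)
  intro i
  ext
  rw [← hf, hf0]
  simp

theorem card_quotient_le [Finite k] {z : K} (hz : z ≠ 0) [FiniteDimensional k⟮z⟯ K]
    (O : Submodule k K) (hO : ∀ x ∈ O, z * x ∈ O) :
    Finite (O ⧸ (O.map (LinearMap.mulLeft k z)).submoduleOf O) ∧
    (O.map (LinearMap.mulLeft k z)).toAddSubgroup.relIndex O.toAddSubgroup ≠ 0 ∧
    (O.map (LinearMap.mulLeft k z)).toAddSubgroup.relIndex O.toAddSubgroup ≤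
      Nat.card k ^ Module.finrank k⟮z⟯ K := by
  set N := (O.map (LinearMap.mulLeft k z)).submoduleOf O with hN
  have hrank : Module.rank k (O ⧸ N) ≤ (Module.finrank k⟮z⟯ K : ℕ) := by
    refine rank_le fun s hs => ?_
    choose a ha using fun i : s => N.mkQ_surjective i
    have hli : LinearIndependent k (fun i => N.mkQ (a i)) := by
      simpa only [ha] using hs
    have := linearIndependent_of_aeval z (fun i => (a i : K))
      (aeval_eq_zero_of_linearIndependent_quotient hz O hO a hli)
    simpa using this.fintype_card_le_finrank
  have hfd : FiniteDimensional k (O ⧸ N) :=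
    Module.rank_lt_aleph0_iff.1 (hrank.trans_lt Cardinal.natCast_lt_aleph0)
  have hfin : Finite (O ⧸ N) := Module.finite_of_finite k
  have hcard : (O.map (LinearMap.mulLeft k z)).toAddSubgroup.relIndex O.toAddSubgroup =
      Nat.card (O ⧸ N) := rfl
  refine ⟨hfin, ?_, ?_⟩
  · rw [hcard]
    exact Nat.card_pos.ne'
  · rw [hcard, Module.natCard_eq_pow_finrank (K := k)]
    refine Nat.pow_le_pow_right Nat.card_pos ?_
    exact Module.finrank_le_of_rank_le hrank

end Generic

namespace Place

variable {k K : Type*} [Field k] [Finite k] [Field K] [Algebra k K]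

theorem ord_eq_zero_of_isAlgebraic (v : Place K) {x : K} (hx : IsAlgebraic k x) : v.ord x = 0 := by
  rcases eq_or_ne x 0 with rfl | h0
  · simp
  have : FiniteDimensional k k⟮x⟯ := adjoin.finiteDimensional hx.isIntegral
  have : Finite k⟮x⟯ := Module.finite_of_finite k
  have hg : AdjoinSimple.gen k x ≠ 0 := fun h => h0 (by simpa using congrArg (algebraMap _ K) h)
  obtain ⟨n, hn, hn1⟩ := isOfFinOrder_iff_pow_eq_one.1 (isOfFinOrder_of_finite (Units.mk0 _ hg))
  have h1 : x ^ n = 1 := by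
    have := congrArg (fun u : k⟮x⟯ˣ => algebraMap k⟮x⟯ K u) hn1
    simpa using this
  have := v.ord_pow x n
  rw [h1, ord_one] at this
  have hn' : (n : ℤ) ≠ 0 := by lia
  exact (mul_eq_zero.1 this.symm).resolve_left hn'

theorem transcendental_of_ord_ne_zero (v : Place K) {x : K} (hx : v.ord x ≠ 0) :
    Transcendental k x := fun h => hx (v.ord_eq_zero_of_isAlgebraic h)

variable (k) in
/-- The elements of order at least `e v` at all `v ∈ T`, as a `k`-subspace. -/
def filtInf (T : Finset (Place K)) (e : Place K → ℤ) : Submodule k K where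
  carrier := {x | ∀ v ∈ T, x ∈ v.filt (e v)}
  zero_mem' v _ := zero_mem _
  add_mem' hx hy v hv := add_mem (hx v hv) (hy v hv)
  smul_mem' c x hx v hv := by
    rcases eq_or_ne c 0 with rfl | hc
    · simp [zero_mem]
    · rw [Algebra.smul_def, mul_mem_filt_iff _ (by simpa),
        v.ord_eq_zero_of_isAlgebraic (isAlgebraic_algebraMap c)]
      simpa using hx v hv

theorem mem_filtInf {T : Finset (Place K)} {e : Place K → ℤ} {x : K} :
    x ∈ filtInf k T e ↔ ∀ v ∈ T, x ∈ v.filt (e v) := Iff.rfl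

theorem relIndex_filtInf (T : Finset (Place K)) (e : Place K → ℕ) :
    (filtInf k T (fun v => e v)).toAddSubgroup.relIndex (filtInf k T 0).toAddSubgroup =
      ∏ v ∈ T, v.resCard ^ e v := by
  let f : (filtInf k T 0).toAddSubgroup →+
      ∀ v : T, (v.1.filt 0) ⧸ (v.1.filt (e v.1)).addSubgroupOf (v.1.filt 0) :=
    { toFun x v := QuotientAddGroup.mk ⟨x.1, x.2 v.1 v.2⟩
      map_zero' := rfl
      map_add' _ _ := rfl }
  have hker : (filtInf k T (fun v => e v)).toAddSubgroup.addSubgroupOf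
      (filtInf k T 0).toAddSubgroup = f.ker := by
    ext x
    simp only [AddSubgroup.mem_addSubgroupOf, Submodule.mem_toAddSubgroup, mem_filtInf,
      AddMonoidHom.mem_ker, funext_iff, Subtype.forall]
    refine forall₂_congr fun v hv => ?_
    change _ ↔ ((QuotientAddGroup.mk _ : (v.filt 0) ⧸ (v.filt (e v)).addSubgroupOf _) = 0)
    rw [QuotientAddGroup.eq_zero_iff, AddSubgroup.mem_addSubgroupOf]
  have hsurj : Function.Surjective f := fun y => by
    choose z hz using fun v => QuotientAddGroup.mk_surjective (y v)
    classical
    obtain ⟨M, hM⟩ : ∃ M : ℕ, ∀ v ∈ T, e v ≤ M := ⟨∑ v ∈ T, e v, fun v hv =>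
      Finset.single_le_sum (fun _ _ => zero_le) hv⟩
    obtain ⟨x, hx⟩ := exists_approx T (fun v => if h : v ∈ T then (z ⟨v, h⟩ : K) else 0) M
    have hx' : ∀ v (hv : v ∈ T), x - z ⟨v, hv⟩ ∈ v.filt (e v) := fun v hv => by
      have := hx v hv
      rw [dif_pos hv] at this
      exact v.filt_anti (by exact_mod_cast hM v hv) this
    refine ⟨⟨x, fun v hv => ?_⟩, ?_⟩
    · have := add_mem (v.filt_anti (by simp) (hx' v hv)) (z ⟨v, hv⟩).2
      simpa using this
    · ext1 v
      rw [← hz v]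
      refine QuotientAddGroup.eq.2 ?_
      rw [AddSubgroup.mem_addSubgroupOf]
      have := neg_mem (hx' v.1 v.2)
      simpa [sub_eq_add_neg, add_comm] using this
  rw [AddSubgroup.relIndex, hker, AddSubgroup.index_ker, AddMonoidHom.range_eq_top.2 hsurj,
    AddSubgroup.card_top, Nat.card_pi, ← Finset.prod_coe_sort T]
  refine Finset.prod_congr rfl fun v _ => ?_
  rw [← relIndex_filt v.1 0, zero_add]
  rfl

variable (k) in
/-- The sum of the degrees of the zeros of `z` is at most the degree of the extension
generated by `z`. -/
theorem prod_resCard_le {z : K} (hz : z ≠ 0) [FiniteDimensional k⟮z⟯ K] (T : Finset (Place K))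
    (hT : ∀ v ∈ T, 0 ≤ v.ord z) :
    ∏ v ∈ T, v.resCard ^ (v.ord z).toNat ≠ 0 ∧
    ∏ v ∈ T, v.resCard ^ (v.ord z).toNat ≤ Nat.card k ^ Module.finrank k⟮z⟯ K := by
  have h := (card_quotient_le hz (filtInf k T 0) (fun x hx v hv => by
    rw [mul_mem_filt_iff _ hz]
    exact v.filt_anti (by have := hT v hv; simp only [Pi.zero_apply]; lia) (hx v hv))).2
  have heq : (filtInf k T 0).map (LinearMap.mulLeft k z) =
      filtInf k T (fun v => (v.ord z).toNat) := by
    ext x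
    simp only [Submodule.mem_map, LinearMap.mulLeft_apply, mem_filtInf]
    constructor
    · rintro ⟨y, hy, rfl⟩ v hv
      rw [mul_mem_filt_iff _ hz, Int.toNat_of_nonneg (hT v hv), sub_self]
      exact hy v hv
    · intro hx
      refine ⟨z⁻¹ * x, fun v hv => ?_, mul_inv_cancel_left₀ hz x⟩
      rw [mul_mem_filt_iff _ (inv_ne_zero hz), ord_inv]
      have := hx v hv
      rw [Int.toNat_of_nonneg (hT v hv)] at this
      simpa using this
  rw [heq, relIndex_filtInf] at h
  exact h

end Place

/-- `K` is an algebraic function field in one variable over `k` (or algebraic over `k`): it is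
finite over `k(z)` for every transcendental element `z`. -/
class IsCurveField (k K : Type*) [Field k] [Field K] [Algebra k K] : Prop where
  finiteDimensional : ∀ z : K, Transcendental k z → FiniteDimensional k⟮z⟯ K

namespace Place

section OfDVR

variable {K : Type*} [Field K]

/-- The place of a discrete valuation ring with fraction field `K`. -/
def ofDVR (V : ValuationSubring K) [IsDiscreteValuationRing V] : Place K where
  val := by
    classical
    exact AddValuation.of
      (fun x => if x = 0 then ⊤ else
        ((-WithZero.log ((IsDiscreteValuationRing.maximalIdeal V).valuation K x) : ℤ) : WithTop ℤ))
      (by simp) (by simp)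
      (fun x y => by
        rcases eq_or_ne x 0 with rfl | hx
        · simp
        rcases eq_or_ne y 0 with rfl | hy
        · simp
        rcases eq_or_ne (x + y) 0 with hxy | hxy
        · simp [hxy]
        simp only [hx, hy, hxy, if_false]
        set v := (IsDiscreteValuationRing.maximalIdeal V).valuation K
        rw [← WithTop.coe_min, WithTop.coe_le_coe, ← neg_sup, neg_le_neg_iff]
        have h := v.map_add x y
        have h0 : v (x + y) ≠ 0 := (Valuation.ne_zero_iff _).2 hxy
        rcases le_max_iff.1 h with h | h
        · exact ((WithZero.log_le_log h0 ((Valuation.ne_zero_iff _).2 hx)).2 h).trans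
            (le_max_left _ _)
        · exact ((WithZero.log_le_log h0 ((Valuation.ne_zero_iff _).2 hy)).2 h).trans
            (le_max_right _ _))
      (fun x y => by
        rcases eq_or_ne x 0 with rfl | hx
        · simp
        rcases eq_or_ne y 0 with rfl | hy
        · simp
        simp only [hx, hy, mul_eq_zero, or_self, if_false, map_mul]
        rw [WithZero.log_mul ((Valuation.ne_zero_iff _).2 hx) ((Valuation.ne_zero_iff _).2 hy),
          neg_add]
        rfl)
  surj n := by
    obtain ⟨x, hx⟩ := (IsDiscreteValuationRing.maximalIdeal V).valuation_surjective K
      (WithZero.exp (-n))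
    have h0 : x ≠ 0 := by
      rintro rfl
      rw [map_zero] at hx
      exact WithZero.exp_ne_zero hx.symm
    refine ⟨x, ?_⟩
    simp [AddValuation.of_apply, h0, hx]

theorem ord_ofDVR_pos (V : ValuationSubring K) [IsDiscreteValuationRing V] {x : K} (h0 : x ≠ 0)
    (hx : x ∈ V.nonunits) : 0 < (ofDVR V).ord x := by
  obtain ⟨hxV, hxm⟩ := ValuationSubring.mem_nonunits_iff_exists_mem_maximalIdeal.1 hx
  have h1 : (IsDiscreteValuationRing.maximalIdeal V).valuation K x < 1 :=
    ((IsDiscreteValuationRing.maximalIdeal V).valuation_lt_one_iff_mem (K := K) ⟨x, hxV⟩).2 hxm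
  have h2 : (ofDVR V).ord x =
      -WithZero.log ((IsDiscreteValuationRing.maximalIdeal V).valuation K x) := by
    apply ord_eq_of_val_eq
    simp [ofDVR, AddValuation.of_apply, h0]
  have h3 := (WithZero.log_lt_log ((Valuation.ne_zero_iff _).2 h0) one_ne_zero).2 h1
  rw [WithZero.log_one] at h3
  lia

end OfDVR

variable {k K : Type*} [Field k] [Finite k] [Field K] [Algebra k K]

variable (k) in
theorem _root_.ValuationSubring.finite_quotient_span [IsCurveField k K] (V : ValuationSubring K)
    (hV : ∀ c : k, algebraMap k K c ∈ V) (x : V) (hx : x ≠ 0) : Finite (V ⧸ Ideal.span {x}) := by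
  have hx0 : (x : K) ≠ 0 := by simpa using hx
  by_cases halg : IsAlgebraic k (x : K)
  · have hint : IsAlgebraic k (x : K)⁻¹ := halg.inv
    have hmem : (x : K)⁻¹ ∈ V := by
      have : FiniteDimensional k k⟮(x : K)⟯ := adjoin.finiteDimensional halg.isIntegral
      have h1 : (algebraMap k K).range ≤ V.toSubring := by
        rintro _ ⟨c, rfl⟩
        exact hV c
      have h2 : IsIntegral V (x : K)⁻¹ := by
        obtain ⟨q, hq, hq0⟩ := hint.isIntegral
        refine ⟨q.map ((algebraMap k K).codRestrict V hV), hq.map _, ?_⟩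
        rw [eval₂_map]
        exact hq0
      obtain ⟨y, hy⟩ := IsIntegrallyClosed.isIntegral_iff.1 h2
      rw [← hy]
      exact y.2
    have : IsUnit x := IsUnit.of_mul_eq_one ⟨_, hmem⟩ (Subtype.ext (mul_inv_cancel₀ hx0))
    rw [Ideal.span_singleton_eq_top.2 this]
    exact Finite.of_subsingleton
  · have := IsCurveField.finiteDimensional (k := k) (x : K) halg
    let O : Submodule k K :=
      { V.toSubring.toAddSubgroup with
        smul_mem' := fun c y hy => by
          rw [Algebra.smul_def]
          exact V.mul_mem _ _ (hV c) hy }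
    obtain ⟨hfin, -⟩ := card_quotient_le hx0 O (fun y hy => V.mul_mem _ _ x.2 hy)
    let f : O →+ V ⧸ Ideal.span {x} :=
      (Ideal.Quotient.mk (Ideal.span {x})).toAddMonoidHom.comp
        { toFun y := (⟨y.1, y.2⟩ : V), map_zero' := rfl, map_add' _ _ := rfl }
    let g : (O ⧸ (O.map (LinearMap.mulLeft k (x : K))).submoduleOf O) → V ⧸ Ideal.span {x} :=
      QuotientAddGroup.lift _ f (by
        rintro ⟨_, hy⟩ ⟨y, hyO, rfl⟩
        refine Ideal.Quotient.eq_zero_iff_mem.2 (Ideal.mem_span_singleton'.2 ⟨⟨y, hyO⟩, ?_⟩)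
        exact Subtype.ext (mul_comm _ _))
    refine Finite.of_surjective g fun y => ?_
    obtain ⟨y, rfl⟩ := Ideal.Quotient.mk_surjective y
    exact ⟨Submodule.Quotient.mk ⟨y.1, y.2⟩, rfl⟩

variable (k) in
theorem _root_.ValuationSubring.isNoetherianRing_of_isCurveField [IsCurveField k K]
    (V : ValuationSubring K) (hV : ∀ c : k, algebraMap k K c ∈ V) : IsNoetherianRing V := by
  refine (isNoetherianRing_iff_ideal_fg V).2 fun I => ?_
  rcases eq_or_ne I ⊥ with rfl | hI
  · exact Submodule.fg_bot
  obtain ⟨x, hxI, hx⟩ := Submodule.exists_mem_ne_zero_of_ne_bot hI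
  have := V.finite_quotient_span k hV x hx
  refine Submodule.fg_of_fg_map_of_fg_inf_ker (Ideal.span {x}).mkQ ?_ ?_
  · exact (isNoetherian_def.1 (isNoetherian_of_finite _ _)) _
  · rw [Submodule.ker_mkQ, inf_eq_right.2 ((Ideal.span_singleton_le_iff_mem _).2 hxI)]
    exact ⟨{x}, by simp [Ideal.span]⟩

variable (k) in
theorem exists_ord_pos [IsCurveField k K] {y : K} (hy : Transcendental k y) :
    ∃ v : Place K, 0 < v.ord y := by
  have hy0 : y ≠ 0 := fun h => hy (h ▸ isAlgebraic_zero)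
  let A : Subring K := (Algebra.adjoin k {y}).toSubring
  let y' : A := ⟨y, Algebra.subset_adjoin rfl⟩
  have hI : Ideal.span {y'} ≠ ⊤ := by
    rw [Ne, Ideal.span_singleton_eq_top]
    intro hu
    obtain ⟨w, hw⟩ := hu.exists_right_inv
    obtain ⟨f, hf⟩ := (Algebra.adjoin_singleton_eq_range_aeval k y).le w.2
    have h1 : aeval y (X * f - 1) = 0 := by
      have := congrArg Subtype.val hw
      simp only [map_sub, map_mul, aeval_X, map_one]
      rw [sub_eq_zero]
      exact (congrArg (y * ·) hf).trans this
    have h2 := (transcendental_iff.1 hy) _ h1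
    have := congrArg (eval 0) h2
    simp at this
  obtain ⟨V, hAV, hyV⟩ := Ideal.image_subset_nonunits_valuationSubring _ hI
  have hV : ∀ c : k, algebraMap k K c ∈ V := fun c =>
    hAV ((Algebra.adjoin k {y}).algebraMap_mem c)
  have hyn : y ∈ V.nonunits := hyV ⟨y', Ideal.mem_span_singleton_self _, rfl⟩
  have := V.isNoetherianRing_of_isCurveField k hV
  have : IsPrincipalIdealRing V := ((IsBezout.TFAE (R := V)).out 0 1).1 this
  have : IsDiscreteValuationRing V :=
    { not_a_field' := fun h => by
        obtain ⟨h1, h2⟩ := ValuationSubring.mem_nonunits_iff_exists_mem_maximalIdeal.1 hyn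
        rw [h, Ideal.mem_bot] at h2
        exact hy0 (congrArg Subtype.val h2) }
  exact ⟨ofDVR V, ord_ofDVR_pos V hy0 hyn⟩

variable (k) in
theorem exists_ord_neg [IsCurveField k K] {y : K} (hy : Transcendental k y) :
    ∃ v : Place K, v.ord y < 0 := by
  obtain ⟨v, hv⟩ := exists_ord_pos k (y := y⁻¹) fun h => hy (by simpa using h.inv)
  exact ⟨v, by simpa using hv⟩

variable (k) in
theorem isAlgebraic_of_forall_ord_nonneg [IsCurveField k K] {x : K}
    (hx : ∀ v : Place K, 0 ≤ v.ord x) : IsAlgebraic k x := by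
  by_contra h
  obtain ⟨v, hv⟩ := exists_ord_neg k h
  exact (hx v).not_gt hv

variable (k) in
theorem resCard_ne_zero [IsCurveField k K] (v : Place K) : v.resCard ≠ 0 := by
  obtain ⟨z, hz, hz1⟩ := v.exists_ord_eq 1
  have := IsCurveField.finiteDimensional (k := k) z (v.transcendental_of_ord_ne_zero (by lia))
  have := (prod_resCard_le k hz {v} (by simp [hz1])).1
  simpa [hz1] using this

variable (k) in
theorem two_le_resCard [IsCurveField k K] (v : Place K) : 2 ≤ v.resCard := by
  have := v.resCard_ne_zero k
  have := v.resCard_ne_one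
  lia

variable (k) in
theorem finite_setOf_ord_pos [IsCurveField k K] (z : K) : {v : Place K | 0 < v.ord z}.Finite := by
  by_cases hz : IsAlgebraic k z
  · simp [ord_eq_zero_of_isAlgebraic _ hz]
  have hz0 : z ≠ 0 := fun h => hz (h ▸ isAlgebraic_zero)
  have := IsCurveField.finiteDimensional (k := k) z hz
  by_contra hinf
  obtain ⟨T, hT, hcard⟩ := Set.Infinite.exists_subset_card_eq hinf
    (Nat.card k ^ Module.finrank k⟮z⟯ K)
  have h1 := (prod_resCard_le k hz0 T (fun v hv => (hT hv).le)).2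
  have h2 : 2 ^ T.card ≤ ∏ v ∈ T, v.resCard ^ (v.ord z).toNat := by
    rw [← Finset.prod_const]
    refine Finset.prod_le_prod' fun v hv => (two_le_resCard k v).trans (Nat.le_self_pow ?_ _)
    have : 0 < v.ord z := hT hv
    lia
  have := T.card.lt_two_pow_self
  lia

variable (k) in
theorem finite_setOf_ord_neg [IsCurveField k K] (z : K) : {v : Place K | v.ord z < 0}.Finite := by
  simpa using finite_setOf_ord_pos k z⁻¹

variable (k) in
theorem finite_setOf_ord_ne_zero [IsCurveField k K] (z : K) :
    {v : Place K | v.ord z ≠ 0}.Finite :=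
  ((finite_setOf_ord_neg k z).union (finite_setOf_ord_pos k z)).subset fun _ hv =>
    lt_or_gt_of_ne hv

variable (k) in
theorem finite_setOf_resCard_le [IsCurveField k K] (y : K) (hy : Transcendental k y) (D : ℕ) :
    {v : Place K | v.resCard ≤ D}.Finite := by
  have hsub : ∀ i j, i < j → y ^ j - y ^ i ≠ 0 := fun i j hij h => by
    have := transcendental_iff.1 hy (X ^ j - X ^ i) (by simpa using h)
    have := congrArg (coeff · j) this
    simp [coeff_X_pow, hij.ne'] at this
  refine ((finite_setOf_ord_neg k y).union (Set.Finite.biUnion (Finset.range (D + 1)).finite_toSet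
    fun i _ => Set.Finite.biUnion (Finset.range (D + 1)).finite_toSet fun j _ =>
      finite_setOf_ord_pos k (y ^ j - y ^ i))).subset fun v hv => ?_
  rcases lt_or_ge (v.ord y) 0 with hneg | hnn
  · exact Or.inl hneg
  right
  have hy0 : y ≠ 0 := fun h => hy (h ▸ isAlgebraic_zero)
  have hmem : ∀ i, y ^ i ∈ v.filt 0 := fun i => by
    rw [mem_filt_iff _ (pow_ne_zero _ hy0), ord_pow]
    positivity
  let Q := v.filt 0 ⧸ (v.filt 1).addSubgroupOf (v.filt 0)
  have hcard : Nat.card Q = v.resCard := rfl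
  have : Finite Q := Nat.finite_of_card_ne_zero (hcard ▸ v.resCard_ne_zero k)
  have : Fintype Q := Fintype.ofFinite Q
  obtain ⟨i, j, hij, h⟩ := Fintype.exists_ne_map_eq_of_card_lt
    (fun i : Fin (D + 1) => (QuotientAddGroup.mk ⟨y ^ (i : ℕ), hmem i⟩ : Q)) (by
      rw [Fintype.card_fin, ← Nat.card_eq_fintype_card, hcard]
      exact Nat.lt_succ_of_le hv)
  wlog hlt : i < j generalizing i j
  · exact this j i hij.symm h.symm (lt_of_le_of_ne (not_lt.1 hlt) hij.symm)
  rw [QuotientAddGroup.eq, AddSubgroup.mem_addSubgroupOf] at h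
  simp only [Set.mem_iUnion]
  refine ⟨i, Finset.mem_coe.2 (Finset.mem_range.2 i.2), j,
    Finset.mem_coe.2 (Finset.mem_range.2 j.2), ?_⟩
  have h0 := hsub i j hlt
  have h1 := (mem_filt_iff v (n := 1) h0).1 (by simpa [sub_eq_neg_add] using h)
  exact h1

end Place

namespace Place

variable {k K : Type*} [Field k] [Finite k] [Field K] [Algebra k K]

theorem algebraMap_mem_filt (v : Place K) (c : k) : algebraMap k K c ∈ v.filt 0 := by
  rcases eq_or_ne c 0 with rfl | hc
  · simp [zero_mem]
  · rw [mem_filt_iff _ (by simpa), v.ord_eq_zero_of_isAlgebraic (isAlgebraic_algebraMap c)]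

theorem pow_mem_filt (v : Place K) {m : ℤ} {x : K} (hx : x ∈ v.filt m) (n : ℕ) :
    x ^ n ∈ v.filt (n * m) := by
  induction n with
  | zero => simp [mem_filt_iff]
  | succ n ih =>
    rw [pow_succ]
    convert v.mul_mem_filt ih hx using 2
    push_cast
    ring

theorem aeval_mem_filt (v : Place K) {z : K} {m : ℤ} (hm : m ≤ 0) (hz : z ∈ v.filt m) (f : k[X])
    (d : ℕ) (hd : f ∈ degreeLT k d) : aeval z f ∈ v.filt (d * m) := by
  rw [aeval_eq_sum_range]
  refine sum_mem fun i _ => ?_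
  by_cases hi : i < d
  · rw [Algebra.smul_def]
    have := v.mul_mem_filt (v.algebraMap_mem_filt (f.coeff i)) (v.pow_mem_filt hz i)
    rw [zero_add] at this
    exact v.filt_anti (by nlinarith) this
  · rw [coeff_eq_zero_of_degree_lt ((mem_degreeLT.1 hd).trans_le (by exact_mod_cast not_lt.1 hi)),
      zero_smul]
    exact zero_mem _

theorem mem_filt_zero_of_isIntegral (v : Place K) {R : Type*} [CommRing R] [Algebra R K]
    (hR : ∀ r : R, algebraMap R K r ∈ v.filt 0) {x : K} (hx : IsIntegral R x) : x ∈ v.filt 0 := by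
  rcases eq_or_ne x 0 with rfl | h0
  · exact zero_mem _
  rw [mem_filt_iff _ h0]
  by_contra! hneg
  obtain ⟨q, hq, hq0⟩ := hx
  rw [hq.as_sum] at hq0
  simp only [eval₂_add, eval₂_pow, eval₂_X, eval₂_finsetSum, eval₂_mul, eval₂_C] at hq0
  have h1 : x ^ q.natDegree ∈ v.filt (q.natDegree * v.ord x + 1) := by
    rw [eq_neg_of_add_eq_zero_left hq0]
    refine neg_mem (sum_mem fun i hi => ?_)
    have := v.mul_mem_filt (hR (q.coeff i)) (v.pow_mem_filt ((v.mem_filt_iff h0).2 le_rfl) i)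
    refine v.filt_anti ?_ this
    have : (i : ℤ) + 1 ≤ q.natDegree := by exact_mod_cast Finset.mem_range.1 hi
    nlinarith
  rw [mem_filt_iff _ (pow_ne_zero _ h0), ord_pow] at h1
  lia

variable (k) in
theorem exists_basis_mem_filt [IsCurveField k K] {z : K} [FiniteDimensional k⟮z⟯ K] :
    ∃ (c : ℕ) (b : Fin (Module.finrank k⟮z⟯ K) → K), LinearIndependent k⟮z⟯ b ∧
      ∀ (v : Place K) j, b j ∈ v.filt (c * min 0 (v.ord z)) := by
  classical
  let b₀ := Module.finBasis k⟮z⟯ K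
  obtain ⟨y, hy, hint⟩ := exists_integral_multiples (Algebra.adjoin k {z}) k⟮z⟯
    (Finset.univ.image b₀)
  have hy' : algebraMap (Algebra.adjoin k {z}) k⟮z⟯ y ≠ 0 := by
    intro h
    have := congrArg (algebraMap k⟮z⟯ K) h
    rw [map_zero] at this
    exact hy (Subtype.ext this)
  let b : Fin (Module.finrank k⟮z⟯ K) → K := fun j => y • b₀ j
  have hb : LinearIndependent k⟮z⟯ b := by
    have := b₀.linearIndependent.units_smul (fun _ => Units.mk0 _ hy')
    exact this
  have hbint : ∀ (v : Place K) j, 0 ≤ v.ord z → b j ∈ v.filt 0 := fun v j hv => by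
    refine v.mem_filt_zero_of_isIntegral (R := Algebra.adjoin k {z}) (fun r => ?_)
      (hint _ (by simp))
    obtain ⟨f, hf⟩ := (Algebra.adjoin_singleton_eq_range_aeval k z).le r.2
    have hz : z ∈ v.filt 0 := by
      rcases eq_or_ne z 0 with rfl | h0
      · exact zero_mem _
      · exact (mem_filt_iff v h0).2 hv
    have := v.aeval_mem_filt le_rfl hz f (f.natDegree + 1) (mem_degreeLT.2 (by
      exact degree_le_natDegree.trans_lt (by exact_mod_cast Nat.lt_succ_self _)))
    rw [mul_zero] at this
    have h2 : algebraMap (Algebra.adjoin k {z}) K r = aeval z f := hf.symm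
    rwa [h2]
  have hT := finite_setOf_ord_neg k z
  refine ⟨∑ j, ∑ v ∈ hT.toFinset, (v.ord (b j)).natAbs, b, hb, fun v j => ?_⟩
  rcases lt_or_ge (v.ord z) 0 with hv | hv
  · have h1 := Finset.single_le_sum (f := fun j => ∑ v ∈ hT.toFinset, (v.ord (b j)).natAbs)
      (fun _ _ => zero_le) (Finset.mem_univ j)
    have h2 := Finset.single_le_sum (f := fun v => (v.ord (b j)).natAbs)
      (fun _ _ => zero_le) (hT.mem_toFinset.2 hv)
    rw [mem_filt_iff _ (hb.ne_zero j), min_eq_right hv.le]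
    set C := ∑ j, ∑ v ∈ hT.toFinset, (v.ord (b j)).natAbs
    have h3 : ((v.ord (b j)).natAbs : ℤ) ≤ C := by exact_mod_cast h2.trans h1
    have h4 : -((v.ord (b j)).natAbs : ℤ) ≤ v.ord (b j) := by lia
    nlinarith
  · rw [min_eq_left hv, mul_zero]
    exact hbint v j hv

variable (k) in
/-- A Riemann type lower bound on the number of functions whose poles are dominated by a multiple
of the polar divisor of `z`. -/
theorem exists_addSubgroup_card_ge [IsCurveField k K] {z : K} (hz : Transcendental k z)
    [FiniteDimensional k⟮z⟯ K] :
    ∃ c : ℕ, ∀ M : ℕ, ∃ A : AddSubgroup K, Nat.card A ≠ 0 ∧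
      Nat.card k ^ (M * Module.finrank k⟮z⟯ K) ≤
        Nat.card k ^ (c * Module.finrank k⟮z⟯ K) * Nat.card A ∧
      ∀ x ∈ A, ∀ v : Place K, x ∈ v.filt (M * min 0 (v.ord z)) := by
  obtain ⟨c, b, hb, hbmem⟩ := exists_basis_mem_filt k (z := z)
  refine ⟨c, fun M => ?_⟩
  generalize Module.finrank k⟮z⟯ K = n at b hb hbmem ⊢
  rcases lt_or_ge M c with hM | hM
  · refine ⟨⊥, by simp, ?_, ?_⟩
    · simpa using Nat.pow_le_pow_right Nat.card_pos (Nat.mul_le_mul_right _ hM.le)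
    · intro x hx v
      rw [AddSubgroup.mem_bot.1 hx]
      exact zero_mem _
  obtain ⟨d, rfl⟩ := Nat.exists_eq_add_of_le' hM
  let L : (Fin n → degreeLT k d) →+ K :=
    { toFun g := ∑ j, aeval z (g j : k[X]) * b j
      map_zero' := by simp
      map_add' f g := by simp [add_mul, Finset.sum_add_distrib] }
  have hL : Function.Injective L := by
    rw [injective_iff_map_eq_zero]
    intro g hg
    ext1 j
    have hmem : ∀ f : k[X], aeval z f ∈ k⟮z⟯ := fun f => algebra_adjoin_le_adjoin k {z}
      ((Algebra.adjoin_singleton_eq_range_aeval k z).ge ⟨f, rfl⟩)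
    have hg' : ∑ j, (⟨aeval z (g j : k[X]), hmem _⟩ : k⟮z⟯) • b j = 0 := hg
    have h1 := Fintype.linearIndependent_iff.1 hb _ hg' j
    exact Subtype.ext (transcendental_iff.1 hz _ (congrArg Subtype.val h1))
  have hcard : Nat.card L.range = Nat.card k ^ (d * n) := by
    rw [← Nat.card_congr (AddMonoidHom.ofInjective hL).toEquiv, Nat.card_fun,
      Nat.card_congr (degreeLTEquiv k d).toEquiv, Nat.card_fun, Nat.card_fin, Nat.card_fin, pow_mul]
  refine ⟨L.range, ?_, ?_, ?_⟩
  · rw [hcard]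
    exact pow_ne_zero _ Nat.card_pos.ne'
  · rw [hcard, ← pow_add, ← add_mul, add_comm]
  · rintro _ ⟨g, rfl⟩ v
    change ∑ j, aeval z (g j : k[X]) * b j ∈ _
    refine sum_mem fun j _ => ?_
    have hz0 : z ≠ 0 := fun h => hz (h ▸ isAlgebraic_zero)
    have h1 := v.aeval_mem_filt (min_le_left 0 (v.ord z))
      ((mem_filt_iff v hz0).2 (min_le_right _ _)) (g j : k[X]) d (g j).2
    have := v.mul_mem_filt h1 (hbmem v j)
    rwa [← add_mul, ← Nat.cast_add] at this

end Place

theorem IntermediateField.adjoin_simple_inv_eq {k K : Type*} [Field k] [Field K] [Algebra k K]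
    (z : K) : k⟮z⁻¹⟯ = k⟮z⟯ := by
  refine le_antisymm ?_ ?_ <;> rw [adjoin_simple_le_iff]
  · exact inv_mem (mem_adjoin_simple_self k z)
  · simpa using inv_mem (mem_adjoin_simple_self k z⁻¹)

theorem Nat.le_of_forall_pow_le_mul_pow {a b C : ℕ} (h : ∀ M, a ^ M ≤ C * b ^ M) : a ≤ b := by
  by_contra! hab
  have hb : b ≠ 0 := by
    rintro rfl
    have := h 1
    simp at this
    lia
  have hb' : (0 : ℝ) < b := by positivity
  obtain ⟨M, hM⟩ := pow_unbounded_of_one_lt (C : ℝ) ((one_lt_div hb').2 (Nat.cast_lt.2 hab))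
  rw [div_pow, lt_div_iff₀ (by positivity)] at hM
  have := h M
  have h2 : ((a ^ M : ℕ) : ℝ) ≤ ((C * b ^ M : ℕ) : ℝ) := Nat.cast_le.2 this
  push_cast at h2
  linarith

namespace Place

section

variable {K : Type*} [Field K]

theorem card_le_pow_mul_card (v : Place K) (hv : v.resCard ≠ 0) (A : AddSubgroup K)
    {m : ℤ} (n : ℕ) (hA : A ≤ v.filt m) :
    Nat.card A ≤ v.resCard ^ n * Nat.card (v.filt (m + n) ⊓ A : AddSubgroup K) := by
  have h1 := AddSubgroup.relIndex_mul_relIndex ⊥ (v.filt (m + n) ⊓ A) A bot_le inf_le_right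
  rw [AddSubgroup.relIndex_bot_left, AddSubgroup.relIndex_bot_left,
    AddSubgroup.inf_relIndex_right] at h1
  have h2 := v.relIndex_filt m n
  have h3 := AddSubgroup.relIndex_le_of_le_right hA (H := v.filt (m + n))
    (h2 ▸ pow_ne_zero n hv)
  rw [h2] at h3
  rw [← h1, mul_comm]
  exact Nat.mul_le_mul_right _ h3

theorem exists_card_le_prod_mul_card (T : Finset (Place K)) (hT : ∀ v ∈ T, v.resCard ≠ 0)
    (A : AddSubgroup K) (m : Place K → ℤ) (n : Place K → ℕ) (hA : ∀ v ∈ T, A ≤ v.filt (m v)) :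
    ∃ B ≤ A, (∀ v ∈ T, B ≤ v.filt (m v + n v)) ∧
      Nat.card A ≤ (∏ v ∈ T, v.resCard ^ n v) * Nat.card B := by
  classical
  induction T using Finset.induction_on with
  | empty => exact ⟨A, le_rfl, by simp, by simp⟩
  | insert v T hv ih =>
    simp only [Finset.mem_insert, forall_eq_or_imp] at hT hA
    obtain ⟨B, hBA, hB, hcard⟩ := ih hT.2 hA.2
    refine ⟨v.filt (m v + n v) ⊓ B, inf_le_right.trans hBA, ?_, ?_⟩
    · simp only [Finset.mem_insert, forall_eq_or_imp]
      exact ⟨inf_le_left, fun w hw => inf_le_right.trans (hB w hw)⟩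
    · rw [Finset.prod_insert hv]
      refine hcard.trans ?_
      have := v.card_le_pow_mul_card hT.1 B (n v) (hBA.trans hA.1)
      calc _ ≤ _ := Nat.mul_le_mul_left _ this
        _ = _ := by ring

end

variable {k K : Type*} [Field k] [Finite k] [Field K] [Algebra k K] [IsCurveField k K]

variable (k) in
theorem card_pow_finrank_le (w : Place K) {f : K} (hw : w.ord f < 0)
    (hf : ∀ u ≠ w, 0 ≤ u.ord f) :
    Nat.card k ^ Module.finrank k⟮f⟯ K ≤ w.resCard ^ (-w.ord f).toNat := by
  have hft : Transcendental k f := w.transcendental_of_ord_ne_zero hw.ne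
  have := IsCurveField.finiteDimensional f hft
  obtain ⟨c, hc⟩ := exists_addSubgroup_card_ge k hft
  set m := (-w.ord f).toNat with hm
  refine Nat.le_of_forall_pow_le_mul_pow (C := Nat.card k ^ (c * Module.finrank k⟮f⟯ K) * w.resCard)
    fun M => ?_
  obtain ⟨A, -, hcard, hA⟩ := hc M
  have h1 : A ≤ w.filt (-(M * m : ℕ)) := fun x hx => by
    have := hA x hx w
    rw [min_eq_right hw.le] at this
    convert this using 2
    push_cast
    rw [hm, Int.toNat_of_nonneg (by lia)]
    ring
  have h2 := w.card_le_pow_mul_card (w.resCard_ne_zero k) A (M * m + 1) h1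
  have h3 : w.filt (-(M * m : ℕ) + (M * m + 1 : ℕ)) ⊓ A = ⊥ := by
    rw [eq_bot_iff]
    rintro x ⟨hx1, hxA⟩
    by_contra hx0
    rw [AddSubgroup.mem_bot] at hx0
    have hx1 := (w.mem_filt_iff hx0).1 hx1
    have hord : ∀ u : Place K, 0 ≤ u.ord x := fun u => by
      rcases eq_or_ne u w with rfl | hu
      · lia
      · have := hA x hxA u
        rw [min_eq_left (hf u hu), mul_zero] at this
        exact (u.mem_filt_iff hx0).1 this
    have := w.ord_eq_zero_of_isAlgebraic (isAlgebraic_of_forall_ord_nonneg k hord)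
    lia
  rw [h3, AddSubgroup.card_bot, mul_one] at h2
  calc _ = Nat.card k ^ (M * Module.finrank k⟮f⟯ K) := by rw [← pow_mul, mul_comm]
    _ ≤ _ := hcard
    _ ≤ _ := Nat.mul_le_mul_left _ h2
    _ = _ := by rw [pow_succ, mul_comm M, pow_mul]; ring

/-- There are functions with a single pole at `w`, whose zero divisor is up to a bounded amount
concentrated at `v`. -/
theorem exists_bounded_zeros (k : Type*) {K : Type*} [Field k] [Finite k] [Field K] [Algebra k K]
    [IsCurveField k K] (v w : Place K) (hvw : v ≠ w) :
    ∃ D : ℕ, ∀ a : ℕ, a ≠ 0 → ∃ f ≠ 0, a ≤ v.ord f ∧ v.ord f ≤ a + D ∧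
      ∀ u, u ≠ v → u ≠ w → 0 ≤ u.ord f ∧ (0 < u.ord f → u.ord f ≤ D ∧ u.resCard ≤ D) := by
  classical
  obtain ⟨y, hy0, hy⟩ := w.exists_ord_eq (-1)
  have hyt : Transcendental k y := w.transcendental_of_ord_ne_zero (by lia)
  have := IsCurveField.finiteDimensional y hyt
  obtain ⟨c, hc⟩ := exists_addSubgroup_card_ge k hyt
  have hTfin := finite_setOf_ord_neg k y
  set T := hTfin.toFinset with hT
  have hwT : w ∈ T := by simp [hT, hy]
  set Q := ∏ u ∈ T.erase w, u.resCard ^ (-u.ord y).toNat with hQ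
  set N := Nat.card k ^ Module.finrank k⟮y⟯ K with hN
  set C := Nat.card k ^ (c * Module.finrank k⟮y⟯ K) with hC
  have hQN : w.resCard * Q ≠ 0 ∧ w.resCard * Q ≤ N := by
    have hfin : FiniteDimensional k⟮y⁻¹⟯ K :=
      IsCurveField.finiteDimensional _ fun h => hyt (by simpa using h.inv)
    have := prod_resCard_le k (inv_ne_zero hy0) T (fun u hu => by
      have : u.ord y < 0 := hTfin.mem_toFinset.1 hu
      rw [ord_inv]
      lia)
    rw [IntermediateField.adjoin_simple_inv_eq, ← Finset.mul_prod_erase _ _ hwT] at this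
    simpa [hy, hQ] using this
  have hC0 : 0 < C := pow_pos Nat.card_pos _
  have hQ0 : 0 < Q := Nat.pos_of_ne_zero (right_ne_zero_of_mul hQN.1)
  have hq := two_le_resCard k w
  refine ⟨C * w.resCard, fun a ha => ?_⟩
  have hva : 0 < v.resCard ^ a := pow_pos (by have := two_le_resCard k v; lia) _
  have hex : ∃ M, C * Q ^ M * v.resCard ^ a < N ^ M := by
    by_contra! H
    have : N ≤ Q := Nat.le_of_forall_pow_le_mul_pow (C := C * v.resCard ^ a) fun M =>
      (H M).trans_eq (by ring)
    nlinarith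
  obtain ⟨M, hM, hmin⟩ : ∃ M, C * Q ^ M * v.resCard ^ a < N ^ M ∧
      ∀ m < M, N ^ m ≤ C * Q ^ m * v.resCard ^ a :=
    ⟨Nat.find hex, Nat.find_spec hex, fun m hm => not_lt.1 (Nat.find_min hex hm)⟩
  have hbound : w.resCard ^ M ≤ C * w.resCard * v.resCard ^ a := by
    rcases M with _ | M
    · simp only [pow_zero, mul_one] at hM
      nlinarith
    · have h1 := hmin M (Nat.lt_succ_self M)
      have h2 := (Nat.pow_le_pow_left hQN.2 M).trans h1
      rw [mul_pow] at h2
      have h3 : w.resCard ^ M ≤ C * v.resCard ^ a :=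
        le_of_mul_le_mul_right (h2.trans_eq (by ring)) (pow_pos hQ0 M)
      calc _ = w.resCard ^ M * w.resCard := pow_succ _ _
        _ ≤ _ := Nat.mul_le_mul_right _ h3
        _ = _ := by ring
  obtain ⟨A, hA0, hcard, hA⟩ := hc M
  obtain ⟨B, hBA, hB, hcardB⟩ := exists_card_le_prod_mul_card (T.erase w)
    (fun u _ => u.resCard_ne_zero k) A (fun u => M * min 0 (u.ord y))
    (fun u => (-u.ord y).toNat * M) (fun u _ x hx => hA x hx u)
  have hB0 : ∀ u ≠ w, B ≤ u.filt 0 := fun u hu => by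
    by_cases huT : u ∈ T
    · have hneg : u.ord y < 0 := hTfin.mem_toFinset.1 huT
      convert hB u (Finset.mem_erase.2 ⟨hu, huT⟩) using 2
      push_cast
      rw [min_eq_right hneg.le, Int.toNat_of_nonneg (by lia)]
      ring
    · have hneg : ¬ u.ord y < 0 := fun h => huT (hTfin.mem_toFinset.2 h)
      intro x hx
      have := hA x (hBA hx) u
      rwa [min_eq_left (by lia), mul_zero] at this
  have hcard' := v.card_le_pow_mul_card (v.resCard_ne_zero k) B a (hB0 v hvw)
  simp_rw [pow_mul, Finset.prod_pow] at hcardB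
  have hcardgt : 1 < Nat.card (v.filt (0 + a) ⊓ B : AddSubgroup K) := by
    by_contra! hle
    have h1 : Nat.card B ≤ v.resCard ^ a :=
      hcard'.trans ((Nat.mul_le_mul_left _ hle).trans_eq (mul_one _))
    have h2 : Nat.card A ≤ Q ^ M * v.resCard ^ a := hcardB.trans (Nat.mul_le_mul_left _ h1)
    have h3 := hcard.trans (Nat.mul_le_mul_left _ h2)
    rw [mul_comm M, pow_mul, ← mul_assoc] at h3
    exact hM.not_ge h3
  obtain ⟨f, hf, hf0⟩ : ∃ f ∈ (v.filt (0 + a) ⊓ B : AddSubgroup K), f ≠ 0 := by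
    by_contra! H
    rw [(AddSubgroup.eq_bot_iff_forall _).2 H] at hcardgt
    simp at hcardgt
  have hva : a ≤ v.ord f := by simpa using (v.mem_filt_iff hf0).1 hf.1
  have hu0 : ∀ u ≠ w, 0 ≤ u.ord f := fun u hu => (u.mem_filt_iff hf0).1 (hB0 u hu hf.2)
  have hft : Transcendental k f := v.transcendental_of_ord_ne_zero (by lia)
  have hwf : w.ord f < 0 := by
    obtain ⟨u, hu⟩ := exists_ord_neg k hft
    rcases eq_or_ne u w with rfl | h
    · exact hu
    · exact absurd hu (hu0 u h).not_gt
  have hwM : -w.ord f ≤ M := by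
    have := (w.mem_filt_iff hf0).1 (hA f (hBA hf.2) w)
    rw [hy] at this
    simp at this
    lia
  have hfin := IsCurveField.finiteDimensional (k := k) f hft
  have hdeg : ∀ U : Finset (Place K), (∀ u ∈ U, u ≠ w) →
      ∏ u ∈ U, u.resCard ^ (u.ord f).toNat ≤ C * w.resCard * v.resCard ^ a := fun U hU =>
    ((prod_resCard_le k hf0 U (fun u hu => hu0 u (hU u hu))).2.trans
      (card_pow_finrank_le k w hwf hu0)).trans
      ((Nat.pow_le_pow_right (by lia) (by lia)).trans hbound)
  have hq2 := two_le_resCard k v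
  obtain ⟨r, hr⟩ : ∃ r : ℕ, (v.ord f).toNat = r + a := ⟨(v.ord f).toNat - a, by lia⟩
  refine ⟨f, hf0, hva, ?_, fun u huv huw => ⟨hu0 u huw, fun hpos => ?_⟩⟩
  · have := hdeg {v} (by simpa using hvw)
    rw [Finset.prod_singleton, hr, pow_add] at this
    have h1 := le_of_mul_le_mul_right this (by assumption)
    have h2 := r.lt_two_pow_self
    have h3 := Nat.pow_le_pow_left hq2 r
    lia
  · have := hdeg {u, v} (by simp [huw, hvw])
    rw [Finset.prod_pair huv, hr, pow_add, ← mul_assoc] at this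
    have h1 := le_of_mul_le_mul_right this (by assumption)
    have h2 : u.resCard ^ (u.ord f).toNat ≤ C * w.resCard :=
      (Nat.le_mul_of_pos_right _ (pow_pos (by lia) _)).trans h1
    have hu2 := two_le_resCard k u
    have h3 := (u.ord f).toNat.lt_two_pow_self
    have h4 := Nat.pow_le_pow_left hu2 (u.ord f).toNat
    refine ⟨by lia, (Nat.le_self_pow (by lia) _).trans h2⟩

/-- Finiteness of the degree zero divisor classes supported on two places. -/
theorem exists_ord_eq_zero_of_ne_of_ne (k : Type*) {K : Type*} [Field k] [Finite k] [Field K]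
    [Algebra k K]
    [IsCurveField k K] (v w : Place K) (hvw : v ≠ w) :
    ∃ x ≠ 0, v.ord x ≠ 0 ∧ ∀ u, u ≠ v → u ≠ w → u.ord x = 0 := by
  obtain ⟨D, hD⟩ := exists_bounded_zeros k v w hvw
  obtain ⟨y, -, hy⟩ := w.exists_ord_eq 1
  have hfin := finite_setOf_resCard_le k y (w.transcendental_of_ord_ne_zero (by lia)) D
  have : Finite {u : Place K | u.resCard ≤ D} := hfin
  choose f hf0 hfa hfD hfu using fun i : ℕ => hD (i * (D + 1) + 1) (by lia)
  obtain ⟨i, j, hij, h⟩ := Finite.exists_ne_map_eq_of_infinite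
    (fun (i : ℕ) (u : {u : Place K | u.resCard ≤ D}) =>
      (⟨min (u.1.ord (f i)).toNat D, by lia⟩ : Fin (D + 1)))
  have hinv := inv_ne_zero (hf0 j)
  refine ⟨f i * (f j)⁻¹, mul_ne_zero (hf0 i) hinv, ?_, fun u huv huw => ?_⟩ <;>
    rw [ord_mul _ (hf0 i) hinv, ord_inv]
  · intro h0
    have h1 := hfa i
    have h2 := hfa j
    have h3 := hfD i
    have h4 := hfD j
    push_cast at h1 h2 h3 h4
    rcases lt_or_gt_of_ne hij with hlt | hlt
    · have : (i : ℤ) + 1 ≤ j := by exact_mod_cast hlt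
      nlinarith
    · have : (j : ℤ) + 1 ≤ i := by exact_mod_cast hlt
      nlinarith
  · obtain ⟨hi, hi'⟩ := hfu i u huv huw
    obtain ⟨hj, hj'⟩ := hfu j u huv huw
    by_cases hu : u.resCard ≤ D
    · have := congrArg Fin.val (congrFun h ⟨u, hu⟩)
      simp only at this
      lia
    · lia

end Place

section

variable (k K : Type*) [Field k] [Field K] [Algebra k K]

theorem IsCurveField.of_trdeg_le_one [Algebra.EssFiniteType k K] (h : Algebra.trdeg k K ≤ 1) :
    IsCurveField k K where
  finiteDimensional z hz := by
    have hb : IsTranscendenceBasis k (fun _ : Unit => z) :=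
      (algebraicIndependent_unique_type_iff.2 hz).isTranscendenceBasis_of_lift_trdeg_le_of_finite
        (by simpa using h)
    have halg := hb.isAlgebraic_field
    rw [Set.range_const] at halg
    have := Algebra.EssFiniteType.of_comp k k⟮z⟯ K
    exact Algebra.finite_of_essFiniteType_of_isAlgebraic

end

theorem RatFunc.trdeg_eq_one (k : Type*) [Field k] : Algebra.trdeg k (RatFunc k) = 1 := by
  have : Algebra.IsAlgebraic k[X] (RatFunc k) := IsLocalization.isAlgebraic _ (nonZeroDivisors k[X])
  rw [← trdeg_add_eq k k[X] (A := RatFunc k), Polynomial.trdeg_of_isDomain,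
    trdeg_eq_zero_iff.2 this, add_zero]

instance IsCurveField.of_finiteDimensional_ratFunc {k K : Type} [Field k] [Field K] [Algebra k K]
    [Algebra (RatFunc k) K] [IsScalarTower k (RatFunc k) K] [FiniteDimensional (RatFunc k) K] :
    IsCurveField k K := by
  have : Algebra.EssFiniteType k[X] (RatFunc k) := .of_isLocalization _ (nonZeroDivisors k[X])
  have : Algebra.EssFiniteType k (RatFunc k) := .comp k k[X] (RatFunc k)
  have : Algebra.EssFiniteType k K := .comp k (RatFunc k) K
  refine IsCurveField.of_trdeg_le_one k K ?_
  rw [← trdeg_add_eq k (RatFunc k) (A := K), RatFunc.trdeg_eq_one,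
    trdeg_eq_zero_iff.2 inferInstance, add_zero]

theorem isPlace_iff_exists_place (p : ℕ) [Fact p.Prime] (K : Type) [Field K] [Algebra (ZMod p) K]
    [Algebra (RatFunc (ZMod p)) K] [IsScalarTower (ZMod p) (RatFunc (ZMod p)) K]
    (v : K → WithTop ℤ) : IsPlace p K v ↔ ∃ P : Place K, ⇑P.val = v := by
  constructor
  · rintro ⟨h0, -, hmul, hadd, hC, hsurj⟩
    have h1 : v 1 = 0 := by simpa using hC 1 one_ne_zero
    exact ⟨⟨AddValuation.of v h0 h1 hadd hmul, hsurj⟩, rfl⟩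
  · rintro ⟨P, rfl⟩
    refine ⟨P.val.map_zero, fun x hx => P.val.ne_top_iff.2 hx, P.val.map_mul, P.val.map_add,
      fun c hc => ?_, P.surj⟩
    have h1 : algebraMap (RatFunc (ZMod p)) K (RatFunc.C c) = algebraMap (ZMod p) K c := by
      rw [← RatFunc.algebraMap_eq_C, ← IsScalarTower.algebraMap_apply]
    have h2 : algebraMap (ZMod p) K c ≠ 0 := by simpa using hc
    rw [h1, P.val_eq h2, P.ord_eq_zero_of_isAlgebraic (isAlgebraic_algebraMap c)]
    rfl

namespace Place

theorem finite_setOf_isAlgebraic (k : Type*) {K : Type*} [Field k] [Finite k] [Field K]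
    [Algebra k K] [IsCurveField k K] (w : Place K) : {x : K | IsAlgebraic k x}.Finite := by
  let Q := w.filt 0 ⧸ (w.filt 1).addSubgroupOf (w.filt 0)
  have : Finite Q := Nat.finite_of_card_ne_zero (w.resCard_ne_zero k)
  have hmem : ∀ x : K, IsAlgebraic k x → x ∈ w.filt 0 := fun x hx => by
    rcases eq_or_ne x 0 with rfl | h0
    · exact zero_mem _
    · exact (w.mem_filt_iff h0).2 (w.ord_eq_zero_of_isAlgebraic hx).ge
  let f : {x : K | IsAlgebraic k x} → Q := fun x => QuotientAddGroup.mk ⟨x, hmem x x.2⟩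
  refine Set.finite_coe_iff.1 (Finite.of_injective f fun x y hxy => ?_)
  have h1 : -(x : K) + y ∈ w.filt 1 :=
    (QuotientAddGroup.eq (s := (w.filt 1).addSubgroupOf (w.filt 0))).1 hxy
  by_contra hne
  have h0 : -(x : K) + y ≠ 0 := fun h => hne (Subtype.ext (neg_add_eq_zero.1 h))
  rw [w.mem_filt_iff h0, w.ord_eq_zero_of_isAlgebraic (IsAlgebraic.add x.2.neg y.2)] at h1
  lia

section

variable {K : Type*} [Field K]

/-- The order at `v` as a homomorphism on units. -/
def ordHom (v : Place K) : Additive Kˣ →ₗ[ℤ] ℤ :=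
  AddMonoidHom.toIntLinearMap
    { toFun x := v.ord (x.toMul : K)
      map_zero' := by simp
      map_add' x y := by simp [ord_mul] }

@[simp] theorem ordHom_apply (v : Place K) (x : Additive Kˣ) :
    v.ordHom x = v.ord (x.toMul : K) := rfl

/-- The orders of a function at the places of `S`. -/
def ordOn (S : Finset (Place K)) : Additive Kˣ →ₗ[ℤ] (S → ℤ) :=
  LinearMap.pi fun v => v.1.ordHom

@[simp] theorem ordOn_apply (S : Finset (Place K)) (x : Additive Kˣ) (v : S) :
    ordOn S x v = v.1.ord (x.toMul : K) := rfl

end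

variable (k : Type*) {K : Type*} [Field k] [Finite k] [Field K] [Algebra k K] [IsCurveField k K]

/-- The part of the divisor of a function outside `S`. -/
def divOutside (S : Finset (Place K)) : Additive Kˣ →ₗ[ℤ] {v // v ∉ S} →₀ ℤ :=
  AddMonoidHom.toIntLinearMap
    { toFun x := Finsupp.ofSupportFinite (fun v => v.1.ord (x.toMul : K))
        ((finite_setOf_ord_ne_zero k (x.toMul : K)).preimage Subtype.val_injective.injOn)
      map_zero' := Finsupp.ext fun v => v.1.ord_one
      map_add' x y := Finsupp.ext fun v => v.1.ord_mul x.toMul.ne_zero y.toMul.ne_zero }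

theorem mem_ker_divOutside {S : Finset (Place K)} {x : Additive Kˣ} :
    x ∈ (divOutside k S).ker ↔ ∀ v ∉ S, v.ord (x.toMul : K) = 0 := by
  rw [LinearMap.mem_ker, Finsupp.ext_iff]
  exact Subtype.forall

theorem isAlgebraic_of_forall_ne_ord_eq_zero (w : Place K) {x : K}
    (h : ∀ v ≠ w, v.ord x = 0) : IsAlgebraic k x := by
  rcases le_total 0 (w.ord x) with hw | hw
  · refine isAlgebraic_of_forall_ord_nonneg k fun v => ?_
    rcases eq_or_ne v w with rfl | hv
    · exact hw
    · exact (h v hv).ge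
  · refine IsAlgebraic.inv_iff.1 (isAlgebraic_of_forall_ord_nonneg k fun v => ?_)
    rw [ord_inv]
    rcases eq_or_ne v w with rfl | hv
    · lia
    · simp [h v hv]

variable [DecidableEq (Place K)]

theorem ordOn_erase_eq_zero_iff {S : Finset (Place K)} {w : Place K} {x : Additive Kˣ}
    (hx : x ∈ (divOutside k S).ker) :
    ordOn (S.erase w) x = 0 ↔ IsAlgebraic k (x.toMul : K) := by
  constructor
  · refine fun h => isAlgebraic_of_forall_ne_ord_eq_zero k w fun v hv => ?_
    by_cases hvS : v ∈ S
    · exact congrFun h ⟨v, Finset.mem_erase.2 ⟨hv, hvS⟩⟩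
    · exact (mem_ker_divOutside k).1 hx v hvS
  · exact fun h => funext fun v => v.1.ord_eq_zero_of_isAlgebraic h

theorem fg_ker_divOutside {S : Finset (Place K)} (hS : S.Nonempty) :
    (divOutside k S).ker.FG := by
  obtain ⟨w, -⟩ := hS
  refine Submodule.fg_of_fg_map_of_fg_inf_ker (ordOn (S.erase w)) (IsNoetherian.noetherian _) ?_
  have : Finite ((divOutside k S).ker ⊓ (ordOn (S.erase w)).ker : Submodule ℤ (Additive Kˣ)) := by
    refine Set.finite_coe_iff.2 (((finite_setOf_isAlgebraic k w).preimage
      (f := fun x : Additive Kˣ => (x.toMul : K)) ?_).subset ?_)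
    · exact (Units.val_injective.comp Additive.toMul.injective).injOn
    · exact fun x hx => (ordOn_erase_eq_zero_iff k hx.1).1 hx.2
  exact Module.Finite.iff_fg.1 inferInstance

theorem finrank_map_ordOn {S : Finset (Place K)} {w : Place K} (hw : w ∈ S) :
    Module.finrank ℤ ((divOutside k S).ker.map (ordOn (S.erase w))) = S.card - 1 := by
  rw [← Finset.card_erase_of_mem hw]
  apply le_antisymm
  · refine (Submodule.finrank_le _).trans ?_
    simp
  · choose x hx0 hx hxu using fun v : S.erase w =>
      exists_ord_eq_zero_of_ne_of_ne k v.1 w (Finset.ne_of_mem_erase v.2)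
    let y : S.erase w → Additive Kˣ := fun v => Additive.ofMul (Units.mk0 (x v) (hx0 v))
    have hy : ∀ v, y v ∈ (divOutside k S).ker := fun v => (mem_ker_divOutside k).2 fun u hu =>
      hxu v u (fun h => hu (h ▸ Finset.mem_of_mem_erase v.2)) (fun h => hu (h ▸ hw))
    have hlin : LinearIndependent ℤ fun v => ordOn (S.erase w) (y v) := by
      rw [Fintype.linearIndependent_iff]
      intro g hg v
      have h := congrFun hg v
      rw [Finset.sum_apply, Finset.sum_eq_single v _ (by simp)] at h
      · exact (mul_eq_zero.1 h).resolve_right (hx v)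
      · intro u _ huv
        have : v.1.ord (x u) = 0 :=
          hxu u v (fun h => huv (Subtype.ext h.symm)) (Finset.ne_of_mem_erase v.2)
        simp [y, this]
    have hlin' : LinearIndependent ℤ fun v =>
        (⟨_, Submodule.mem_map_of_mem (hy v)⟩ : (divOutside k S).ker.map (ordOn (S.erase w))) :=
      LinearIndependent.of_comp (Submodule.subtype _) hlin
    simpa using hlin'.fintype_card_le_finrank

/-- Dirichlet's unit theorem for function fields. -/
theorem exists_sUnit_hom {S : Finset (Place K)} (hS : S.Nonempty) :
    ∃ φ : Additive Kˣ →ₗ[ℤ] (Fin (S.card - 1) → ℤ),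
      (∀ y, ∃ x ∈ (divOutside k S).ker, φ x = y) ∧
      ∀ x ∈ (divOutside k S).ker, (φ x = 0 ↔ IsAlgebraic k (x.toMul : K)) := by
  obtain ⟨w, hw⟩ := hS
  let e := (Module.finBasisOfFinrankEq ℤ _ (finrank_map_ordOn k hw)).equivFun
  let r := (ordOn (S.erase w)).submoduleMap (divOutside k S).ker
  obtain ⟨φ, hφ⟩ := (divOutside k S).exists_extend_ker_of_finsupp (e.toLinearMap ∘ₗ r)
  refine ⟨φ, fun y => ?_, fun x hx => ?_⟩
  · obtain ⟨x, hx⟩ := (ordOn (S.erase w)).submoduleMap_surjective _ (e.symm y)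
    refine ⟨x, x.2, ?_⟩
    rw [hφ x]
    exact (e.eq_symm_apply).1 hx
  · rw [hφ ⟨x, hx⟩, ← ordOn_erase_eq_zero_iff k (w := w) hx, LinearMap.comp_apply,
      LinearEquiv.coe_coe, LinearEquiv.map_eq_zero_iff, Subtype.ext_iff]
    rfl

end Place

end Curve

theorem Place.coe_val_injective {K : Type*} [Field K] :
    Function.Injective fun P : Place K => ⇑P.val := fun _ _ h =>
  Place.ext_ord fun x _ => congrArg (WithTop.untopD 0) (congrFun h x)

theorem isSUnit_iff (p : ℕ) [Fact p.Prime] (K : Type) [Field K] [Algebra (ZMod p) K]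
    [Algebra (RatFunc (ZMod p)) K] [IsScalarTower (ZMod p) (RatFunc (ZMod p)) K]
    [FiniteDimensional (RatFunc (ZMod p)) K] (S : Finset (K → WithTop ℤ)) (x : Kˣ) :
    IsSUnit p K S x ↔ Additive.ofMul x ∈ (Place.divOutside (ZMod p)
      (S.preimage (fun P : Place K => ⇑P.val) Place.coe_val_injective.injOn)).ker := by
  rw [Place.mem_ker_divOutside]
  simp only [Finset.mem_preimage, toMul_ofMul]
  constructor
  · intro h P hP
    exact P.ord_eq_of_val_eq (h P.val ((isPlace_iff_exists_place p K _).2 ⟨P, rfl⟩) hP)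
  · intro h v hv hvS
    obtain ⟨P, rfl⟩ := (isPlace_iff_exists_place p K v).1 hv
    rw [P.val_eq x.ne_zero, h P hvS]
    rfl

/-- Let `K` be a finite extension of `F_p(t)` and `S` a nonempty finite set of places
of `K`.  Then the group `R_S*` of `S`-units is a finitely generated abelian group
whose quotient by the group of constants `K* ∩ F̄_p` (the elements of `K*` algebraic
over `F_p`) is free of rank `|S| − 1`:  there is a homomorphism
`φ : Kˣ →* ℤ^{|S|−1}` whose restriction to the `S`-units is surjective with kernel
exactly the constants. -/
theorem sUnit_group_finitely_generated_free_quotient (p : ℕ) [Fact p.Prime]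
    (K : Type) [Field K] [Algebra (ZMod p) K] [Algebra (RatFunc (ZMod p)) K]
    [IsScalarTower (ZMod p) (RatFunc (ZMod p)) K]
    [FiniteDimensional (RatFunc (ZMod p)) K]
    (S : Finset (K → WithTop ℤ)) (hSne : S.Nonempty)
    (hSpl : ∀ v ∈ S, IsPlace p K v) :
    (∃ F : Finset Kˣ, (∀ x ∈ F, IsSUnit p K S x) ∧
      ∀ x : Kˣ, IsSUnit p K S x → x ∈ Subgroup.closure (F : Set Kˣ)) ∧
    ∃ φ : Kˣ →* Multiplicative (Fin (S.card - 1) → ℤ),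
      (∀ y : Multiplicative (Fin (S.card - 1) → ℤ),
        ∃ x : Kˣ, IsSUnit p K S x ∧ φ x = y) ∧
      (∀ x : Kˣ, IsSUnit p K S x →
        (φ x = 1 ↔ IsAlgebraic (ZMod p) (x : K))) := by
  classical
  let S' := S.preimage (fun P : Place K => ⇑P.val) Place.coe_val_injective.injOn
  have himg : S'.image (fun P : Place K => ⇑P.val) = S := by
    rw [Finset.image_preimage, Finset.filter_true_of_mem]
    exact fun v hv => (isPlace_iff_exists_place p K v).1 (hSpl v hv)
  have hcard : S.card = S'.card := by
    conv_lhs => rw [← himg]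
    exact Finset.card_image_of_injective _ Place.coe_val_injective
  have hS' : S'.Nonempty := by rwa [← Finset.card_pos, ← hcard, Finset.card_pos]
  constructor
  · obtain ⟨F, hF⟩ := Place.fg_ker_divOutside (ZMod p) hS'
    refine ⟨F.image Additive.toMul, fun x hx => ?_, fun x hx => ?_⟩
    · obtain ⟨y, hy, rfl⟩ := Finset.mem_image.1 hx
      exact (isSUnit_iff p K S _).2 (hF ▸ Submodule.subset_span hy)
    · rw [isSUnit_iff, ← hF] at hx
      have key : ∀ y ∈ Submodule.span ℤ (F : Set (Additive Kˣ)),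
          y.toMul ∈ Subgroup.closure (F.image Additive.toMul : Set Kˣ) := fun y hy => by
        induction hy using Submodule.span_induction with
        | mem y hy =>
          exact Subgroup.subset_closure (Finset.mem_coe.2 (Finset.mem_image_of_mem _ hy))
        | zero => exact one_mem _
        | add y z _ _ hy hz => exact mul_mem hy hz
        | smul n y _ hy => exact zpow_mem hy n
      exact key _ hx
  · rw [hcard]
    obtain ⟨φ, hsurj, hker⟩ := Place.exists_sUnit_hom (ZMod p) hS'
    refine ⟨AddMonoidHom.toMultiplicativeRight φ.toAddMonoidHom, fun y => ?_, fun x hx => ?_⟩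
    · obtain ⟨x, hx, hxy⟩ := hsurj y.toAdd
      exact ⟨x.toMul, (isSUnit_iff p K S _).2 hx, congrArg Multiplicative.ofAdd hxy⟩
    · exact hker _ ((isSUnit_iff p K S x).1 hx)
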